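/- Suppose S is smooth, let 1 ≤ i ≤ n−p, and suppose that for a generic choice of a ∈ ℂ^{(n−p−i+1)×n} the classic polar variety W_{K^{n−p−i}(\underline a)}(S) is nonempty. Fix such a generic full-rank a. Then for every regular (smooth) point x of W_{K^{n−p−i}(\underline a)}(S): x does not belong to Δ_i if and only if the fiber ω_i^{-1}(x) is a zero-dimensional variety; and in this case the morphism of algebraic varieties ω_i : H_i → W_{K^{n−p−i}(\underline a)}(S) is unramified at every point of ω_i^{-1}(x). -/

import Mathlib

open MvPolynomial

noncomputable section

/-- The Zariski closure of a subset of the affine space `σ → ℂ`. -/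
def zcl {σ : Type} (T : Set (σ → ℂ)) : Set (σ → ℂ) :=
  MvPolynomial.zeroLocus ℂ (MvPolynomial.vanishingIdeal ℂ T)

/-- Zariski open subsets of the affine space `σ → ℂ`. -/
def ZOpen {σ : Type} (U : Set (σ → ℂ)) : Prop :=
  ∃ I : Ideal (MvPolynomial σ ℂ), U = {x | ∃ f ∈ I, MvPolynomial.eval x f ≠ 0}

/-- Zariski open subsets of the space of `m × n` complex matrices. -/
def ZOpenMat {m n : ℕ} (U : Set (Matrix (Fin m) (Fin n) ℂ)) : Prop :=
  ∃ I : Ideal (MvPolynomial (Fin m × Fin n) ℂ),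
    U = {a | ∃ f ∈ I, MvPolynomial.eval (fun q => a q.1 q.2) f ≠ 0}

/-- `T` is of pure dimension `d`: every irreducible component of (the Zariski closure of) `T`,
i.e. every minimal prime over its vanishing ideal, has coordinate ring of Krull dimension `d`. -/
def IsPureDim {σ : Type} (T : Set (σ → ℂ)) (d : ℕ) : Prop :=
  ∀ P ∈ (MvPolynomial.vanishingIdeal ℂ T).minimalPrimes,
    ringKrullDim (MvPolynomial σ ℂ ⧸ P) = (d : WithBot (WithTop ℕ))

/-- The Zariski tangent space at a point `x` of (the Zariski closure of) a subset `T`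
of affine space: the common kernel of the differentials at `x` of all polynomials
vanishing on `T`. -/
def tangentAt {σ : Type} [Fintype σ] [DecidableEq σ] (T : Set (σ → ℂ)) (x : σ → ℂ) :
    Submodule ℂ (σ → ℂ) :=
  ⨅ (f : MvPolynomial σ ℂ) (_ : f ∈ MvPolynomial.vanishingIdeal ℂ T),
    LinearMap.ker
      (∑ l, MvPolynomial.eval x (MvPolynomial.pderiv l f) •
        (LinearMap.proj l : (σ → ℂ) →ₗ[ℂ] ℂ))

/-- `rs` is a regular sequence in the commutative ring `R`. -/
def IsRegSeq {R : Type*} [CommRing R] (rs : List R) : Prop :=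
  Ideal.span {x | x ∈ rs} ≠ ⊤ ∧
  ∀ j, j < rs.length → ∀ b : R,
    rs.getD j 0 * b ∈ Ideal.span {x | x ∈ rs.take j} →
    b ∈ Ideal.span {x | x ∈ rs.take j}

/-- The common zero set in `ℂⁿ` of polynomials `F₁, …, F_p ∈ ℚ[X₁, …, Xₙ]`. -/
def zeroSetC {n p : ℕ} (F : Fin p → MvPolynomial (Fin n) ℚ) : Set (Fin n → ℂ) :=
  {x | ∀ k, MvPolynomial.aeval x (F k) = 0}

/-- The Jacobian matrix `[∂F_k/∂X_l]` evaluated at `x ∈ ℂⁿ`. -/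
def jacC {n p : ℕ} (F : Fin p → MvPolynomial (Fin n) ℚ) (x : Fin n → ℂ) :
    Matrix (Fin p) (Fin n) ℂ :=
  Matrix.of fun k l => MvPolynomial.aeval x (MvPolynomial.pderiv l (F k))

/-- The set of regular points of `S = {F₁ = 0, …, F_p = 0}`: points of `S` where the
Jacobian has maximal rank `p`. -/
def SregC {n p : ℕ} (F : Fin p → MvPolynomial (Fin n) ℚ) : Set (Fin n → ℂ) :=
  {x | x ∈ zeroSetC F ∧ (jacC F x).rank = p}

/-- The classic polar variety: the Zariski closure of the locus of regular points of `S`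
where the matrix obtained by appending the rows of `a` to the Jacobian has rank at
most `r` (i.e. where all `(r+1)`-minors vanish). -/
def Wclassic {n p m : ℕ} (F : Fin p → MvPolynomial (Fin n) ℚ)
    (a : Matrix (Fin m) (Fin n) ℂ) (r : ℕ) : Set (Fin n → ℂ) :=
  zcl {x | x ∈ SregC F ∧ (Matrix.fromRows (jacC F x) a).rank ≤ r}

/-- The dual polar variety: as `Wclassic`, with appended rows `(a_{k,1} - X₁, …, a_{k,n} - Xₙ)`. -/
def Wdual {n p m : ℕ} (F : Fin p → MvPolynomial (Fin n) ℚ)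
    (a : Matrix (Fin m) (Fin n) ℂ) (r : ℕ) : Set (Fin n → ℂ) :=
  zcl {x | x ∈ SregC F ∧
    (Matrix.fromRows (jacC F x) (Matrix.of fun k l => a k l - x l)).rank ≤ r}

/-- `F₁, …, F_p` generate the full vanishing ideal of their zero set (over `ℂ`);
this encodes that `(F₁, …, F_p)` is reduced (radical) and the ideal of definition of `S`. -/
def idealOfDef {n p : ℕ} (F : Fin p → MvPolynomial (Fin n) ℚ) : Prop :=
  MvPolynomial.vanishingIdeal ℂ (zeroSetC F) =
    Ideal.span (Set.range fun k => MvPolynomial.map (algebraMap ℚ ℂ) (F k))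

/-- The submatrix of the first `m` rows of a matrix. -/
def firstRows {N n' m : ℕ} (a : Matrix (Fin N) (Fin n') ℂ) (h : m ≤ N) :
    Matrix (Fin m) (Fin n') ℂ :=
  Matrix.of fun k l => a (Fin.castLE h k) l

/-- The matrix obtained by deleting row `h`. -/
def rowErase {m n' : ℕ} (a : Matrix (Fin (m + 1)) (Fin n') ℂ) (h : Fin (m + 1)) :
    Matrix (Fin m) (Fin n') ℂ :=
  Matrix.of fun k l => a (h.succAbove k) l

/-- The real trace `S_ℝ := S ∩ ℝⁿ`, as a subset of Euclidean space. -/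
def SR {n p : ℕ} (F : Fin p → MvPolynomial (Fin n) ℚ) : Set (EuclideanSpace ℝ (Fin n)) :=
  {x | (fun j => (x j : ℂ)) ∈ zeroSetC F}

/-- `C` is a connected component of `T`. -/
def IsConnCompOf {α : Type*} [TopologicalSpace α] (C T : Set α) : Prop :=
  C.Nonempty ∧ C ⊆ T ∧ IsPreconnected C ∧
    ∀ D, C ⊆ D → D ⊆ T → IsPreconnected D → D = C

end

/-- The affine cone over the variety `H_i` attached to a fixed matrix `a`. -/
def HconeA {n p m : ℕ} (F : Fin p → MvPolynomial (Fin n) ℚ)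
    (a : Matrix (Fin m) (Fin n) ℂ) : Set ((Fin n ⊕ (Fin p ⊕ Fin m)) → ℂ) :=
  {q | (fun l => q (Sum.inl l)) ∈ SregC F ∧
    (fun s => q (Sum.inr s)) ≠ (0 : Fin p ⊕ Fin m → ℂ) ∧
    Matrix.vecMul (fun s => q (Sum.inr s))
      (Matrix.fromRows (jacC F fun l => q (Sum.inl l)) a) = 0}

/-- The fiber of the canonical projection `ω_i : H_i → ℂⁿ` over `x`, as a set of
projective points. -/
noncomputable def omegaFiber {n p m : ℕ} (F : Fin p → MvPolynomial (Fin n) ℚ)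
    (a : Matrix (Fin m) (Fin n) ℂ) (x : Fin n → ℂ) :
    Set (Projectivization ℂ (Fin p ⊕ Fin m → ℂ)) :=
  {w | Matrix.vecMul w.rep (Matrix.fromRows (jacC F x) a) = 0}

/-- `Δ_i`: the set of points of `S` where the matrix obtained by appending the rows of
`a` to the Jacobian has rank at most `n - i - 1`. -/
def DeltaSet {n p m : ℕ} (F : Fin p → MvPolynomial (Fin n) ℚ)
    (a : Matrix (Fin m) (Fin n) ℂ) (i : ℕ) : Set (Fin n → ℂ) :=
  {x | x ∈ zeroSetC F ∧ (Matrix.fromRows (jacC F x) a).rank ≤ n - i - 1}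

theorem Matrix.finrank_ker_vecMulLinear_add_rank {ι κ K : Type*} [Field K] [Fintype ι] [Fintype κ]
    (N : Matrix ι κ K) :
    Module.finrank K (LinearMap.ker N.vecMulLinear) + N.rank = Fintype.card ι := by
  have h := LinearMap.finrank_range_add_finrank_ker N.vecMulLinear
  rw [Module.finrank_fintype_fun_eq_card, range_vecMulLinear,
    ← Matrix.rank_eq_finrank_span_row] at h
  omega

theorem Matrix.exists_mul_eq_one_of_rank_eq_card {ι κ K : Type*} [Field K] [Fintype ι] [Fintype κ]
    [DecidableEq ι] [DecidableEq κ] (N : Matrix ι κ K) (h : N.rank = Fintype.card ι) :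
    ∃ B : Matrix κ ι K, N * B = 1 := by
  rw [← Matrix.mulVec_surjective_iff_exists_right_inverse]
  have htop : LinearMap.range N.mulVecLin = ⊤ := by
    apply Submodule.eq_top_of_finrank_eq
    rw [Module.finrank_fintype_fun_eq_card, ← h, Matrix.rank]
  exact LinearMap.range_eq_top.1 htop

/-- The points of projective space lying in a nonzero linear subspace form a finite set if and
only if the subspace is a line. -/
theorem Projectivization.finite_rep_mem_iff_finrank_eq_one {K V : Type*} [Field K] [Infinite K]
    [AddCommGroup V] [Module K V] [FiniteDimensional K V] (L : Submodule K V)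
    (hL : 1 ≤ Module.finrank K L) :
    {w : Projectivization K V | w.rep ∈ L}.Finite ↔ Module.finrank K L = 1 := by
  constructor
  · intro hfin
    by_contra hne
    have hlt : 1 < Module.finrank K L := by omega
    have : Nontrivial L := Module.nontrivial_of_finrank_pos (R := K) (by omega)
    obtain ⟨u, hu⟩ := exists_ne (0 : L)
    obtain ⟨v, huv⟩ := exists_linearIndependent_pair_of_one_lt_finrank hlt hu
    have hind := fun s t => LinearIndependent.pair_iff.1 huv s t
    have hnz : ∀ t : K, ((u + t • v : L) : V) ≠ 0 := by
      intro t ht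
      have h0 : (1 : K) • u + t • v = 0 := by
        rw [one_smul]
        exact Subtype.ext ht
      exact one_ne_zero (hind 1 t h0).1
    refine Set.infinite_of_injective_forall_mem
      (f := fun t : K => Projectivization.mk K ((u + t • v : L) : V) (hnz t)) ?_ ?_ hfin
    · intro s t hst
      obtain ⟨c, hc⟩ := (Projectivization.mk_eq_mk_iff' K _ _ _ _).1 hst
      have hc' : c • (u + t • v) = u + s • v := Subtype.ext hc
      have h0 : (c - 1) • u + (c * t - s) • v = 0 := by
        rw [← sub_eq_zero] at hc'
        rw [← hc']
        module
      obtain ⟨h1, h2⟩ := hind _ _ h0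
      rw [sub_eq_zero.1 h1, one_mul] at h2
      exact (sub_eq_zero.1 h2).symm
    · intro t
      obtain ⟨c, hc⟩ := Projectivization.exists_smul_eq_mk_rep K ((u + t • v : L) : V) (hnz t)
      rw [Set.mem_ofPred_eq, ← hc]
      exact L.smul_mem _ (u + t • v).2
  · intro h
    obtain ⟨v, hv, hspan⟩ := finrank_eq_one_iff'.1 h
    have hv' : (v : V) ≠ 0 := fun h0 => hv (Subtype.ext h0)
    refine (Set.finite_singleton (Projectivization.mk K (v : V) hv')).subset ?_
    intro w hw
    obtain ⟨c, hc⟩ := hspan ⟨w.rep, hw⟩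
    rw [Set.mem_singleton_iff, ← w.mk_rep, Projectivization.mk_eq_mk_iff']
    exact ⟨c, congrArg Subtype.val hc⟩

/-- The matrix of polynomials obtained by appending the rows of the constant matrix `a` to the
Jacobian of `F`. -/
noncomputable def polarMatrixPoly {n p m : ℕ} (F : Fin p → MvPolynomial (Fin n) ℚ)
    (a : Matrix (Fin m) (Fin n) ℂ) :
    Matrix (Fin p ⊕ Fin m) (Fin n) (MvPolynomial (Fin n) ℂ) :=
  Matrix.fromRows
    (Matrix.of fun k l => MvPolynomial.map (algebraMap ℚ ℂ) (MvPolynomial.pderiv l (F k)))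
    (a.map MvPolynomial.C)

theorem eval_polarMatrixPoly {n p m : ℕ} (F : Fin p → MvPolynomial (Fin n) ℚ)
    (a : Matrix (Fin m) (Fin n) ℂ) (x : Fin n → ℂ) (s : Fin p ⊕ Fin m) (l : Fin n) :
    MvPolynomial.eval x (polarMatrixPoly F a s l) = Matrix.fromRows (jacC F x) a s l := by
  rcases s with s | s
  · simp [polarMatrixPoly, jacC, MvPolynomial.eval_map, MvPolynomial.aeval_def]
  · simp [polarMatrixPoly]

theorem zcl_subset_zeroSetC {n p : ℕ} (F : Fin p → MvPolynomial (Fin n) ℚ)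
    {T : Set (Fin n → ℂ)} (hT : T ⊆ zeroSetC F) : zcl T ⊆ zeroSetC F := by
  intro x hx k
  have h := hx (MvPolynomial.map (algebraMap ℚ ℂ) (F k)) fun y hy => by
    simpa [MvPolynomial.aeval_map_algebraMap] using hT hy k
  simpa [MvPolynomial.aeval_map_algebraMap] using h

/-- The condition that the Jacobian of `F` with the rows of `a` appended has not full row rank is
Zariski closed. -/
theorem rank_lt_of_mem_zcl {n p m : ℕ} (F : Fin p → MvPolynomial (Fin n) ℚ)
    (a : Matrix (Fin m) (Fin n) ℂ) {T : Set (Fin n → ℂ)}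
    (hT : ∀ y ∈ T, (Matrix.fromRows (jacC F y) a).rank < p + m)
    {x : Fin n → ℂ} (hx : x ∈ zcl T) :
    (Matrix.fromRows (jacC F x) a).rank < p + m := by
  by_contra hge
  have hcard : Fintype.card (Fin p ⊕ Fin m) = p + m := by simp
  have hle := (Matrix.fromRows (jacC F x) a).rank_le_card_height
  obtain ⟨B, hB⟩ := Matrix.exists_mul_eq_one_of_rank_eq_card
    (Matrix.fromRows (jacC F x) a) (by omega)
  let M : Matrix (Fin p ⊕ Fin m) (Fin p ⊕ Fin m) (MvPolynomial (Fin n) ℂ) :=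
    polarMatrixPoly F a * B.map (MvPolynomial.C (σ := Fin n))
  have heval : ∀ y, MvPolynomial.eval y M.det =
      (Matrix.fromRows (jacC F y) a * B).det := by
    intro y
    rw [RingHom.map_det]
    congr 1
    ext s t
    simp [M, Matrix.mul_apply, eval_polarMatrixPoly]
  have h := hx M.det fun y hy => by
    rw [MvPolynomial.aeval_eq_eval, heval]
    by_contra hdet
    have hrank := Matrix.rank_of_isUnit _
      ((Matrix.isUnit_iff_isUnit_det _).2 (isUnit_iff_ne_zero.2 hdet))
    have := (Matrix.fromRows (jacC F y) a).rank_mul_le_left B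
    have := hT y hy
    omega
  rw [MvPolynomial.aeval_eq_eval, heval, hB, Matrix.det_one] at h
  exact one_ne_zero h

theorem mem_tangentAt {σ : Type} [Fintype σ] [DecidableEq σ] (T : Set (σ → ℂ)) (x v : σ → ℂ) :
    v ∈ tangentAt T x ↔ ∀ f ∈ MvPolynomial.vanishingIdeal ℂ T,
      ∑ l, MvPolynomial.eval x (MvPolynomial.pderiv l f) * v l = 0 := by
  simp [tangentAt, Submodule.mem_iInf, LinearMap.sum_apply]

/-- The derivative of a polynomial along an affine line. -/
theorem derivative_aeval_line {σ R : Type*} [Fintype σ] [CommRing R]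
    (x v : σ → R) (f : MvPolynomial σ R) :
    Polynomial.derivative
      (MvPolynomial.aeval (fun l => Polynomial.C (x l) + Polynomial.C (v l) * Polynomial.X) f) =
    ∑ l, MvPolynomial.aeval (fun l => Polynomial.C (x l) + Polynomial.C (v l) * Polynomial.X)
      (MvPolynomial.pderiv l f) * Polynomial.C (v l) := by
  induction f using MvPolynomial.induction_on with
  | C a => simp [Polynomial.algebraMap_eq]
  | add f g hf hg => simp [hf, hg, add_mul, Finset.sum_add_distrib]
  | mul_X f j h =>
    set φ := MvPolynomial.aeval (R := R)
      (fun l => Polynomial.C (x l) + Polynomial.C (v l) * Polynomial.X) with hφ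
    have hX : Polynomial.derivative (φ (MvPolynomial.X j)) = Polynomial.C (v j) := by simp [hφ]
    have hsum : ∑ l, φ (MvPolynomial.pderiv l (MvPolynomial.X j)) * Polynomial.C (v l) =
        Polynomial.C (v j) := by
      rw [Finset.sum_eq_single j (fun l _ hl => by
        rw [MvPolynomial.pderiv_X_of_ne hl.symm, map_zero, zero_mul]) (by simp)]
      simp
    rw [map_mul, Polynomial.derivative_mul, h, hX, ← hsum, Finset.sum_mul,
      Finset.mul_sum, ← Finset.sum_add_distrib]
    refine Finset.sum_congr rfl fun l _ => ?_
    rw [Derivation.leibniz, smul_eq_mul, smul_eq_mul, map_add, map_mul, map_mul]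
    ring

/-- If `T` contains the points `x + t • v` for infinitely many `t`, then `v` is tangent to `T`
at `x`. -/
theorem mem_tangentAt_of_infinite {σ : Type} [Fintype σ] [DecidableEq σ] (T : Set (σ → ℂ))
    (x v : σ → ℂ) (h : {t : ℂ | x + t • v ∈ T}.Infinite) : v ∈ tangentAt T x := by
  rw [mem_tangentAt]
  intro f hf
  set φ : MvPolynomial σ ℂ →ₐ[ℂ] Polynomial ℂ :=
    MvPolynomial.aeval (fun l => Polynomial.C (x l) + Polynomial.C (v l) * Polynomial.X) with hφ
  have heval : ∀ (t : ℂ) (g : MvPolynomial σ ℂ),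
      (φ g).eval t = MvPolynomial.eval (x + t • v) g := by
    intro t g
    have : ((Polynomial.aeval t).comp φ) = MvPolynomial.aeval (x + t • v) := by
      ext l
      simp only [hφ, AlgHom.comp_apply, MvPolynomial.aeval_X, map_add, map_mul, Polynomial.aeval_C,
        Polynomial.aeval_X, Pi.add_apply, Pi.smul_apply, smul_eq_mul, Algebra.algebraMap_self,
        RingHom.id_apply]
      ring
    simpa [Polynomial.coe_aeval_eq_eval, MvPolynomial.aeval_eq_eval] using
      DFunLike.congr_fun this g
  have hzero : φ f = 0 := by
    refine Polynomial.eq_zero_of_infinite_isRoot _ (h.mono fun t ht => ?_)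
    have := hf _ ht
    rw [MvPolynomial.aeval_eq_eval] at this
    rw [Set.mem_ofPred_eq, Polynomial.IsRoot.def, heval, this]
  have hder := derivative_aeval_line x v f
  rw [← hφ, hzero, Polynomial.derivative_zero] at hder
  have h0 := congrArg (Polynomial.eval 0) hder
  simpa [Polynomial.eval_finsetSum, heval] using h0.symm

theorem mem_ker_funLeft_inl {α β : Type*} (v : α ⊕ β → ℂ) :
    v ∈ LinearMap.ker (LinearMap.funLeft ℂ ℂ (Sum.inl : α → α ⊕ β)) ↔
      ∀ l, v (Sum.inl l) = 0 := by
  rw [LinearMap.mem_ker, funext_iff]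
  rfl

theorem add_smul_mem_HconeA {n p m : ℕ} {F : Fin p → MvPolynomial (Fin n) ℚ}
    {a : Matrix (Fin m) (Fin n) ℂ} {q : (Fin n ⊕ (Fin p ⊕ Fin m)) → ℂ} (hq : q ∈ HconeA F a)
    {t : ℂ} (ht : t ≠ -1) :
    q + t • Sum.elim (0 : Fin n → ℂ) (fun s => q (Sum.inr s)) ∈ HconeA F a := by
  obtain ⟨h1, h2, h3⟩ := hq
  have hl : (fun l => (q + t • Sum.elim (0 : Fin n → ℂ) (fun s => q (Sum.inr s))) (Sum.inl l)) =
      fun l : Fin n => q (Sum.inl l) := by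
    ext l
    simp
  have hr : (fun s => (q + t • Sum.elim (0 : Fin n → ℂ) (fun s => q (Sum.inr s))) (Sum.inr s)) =
      (1 + t) • fun s : Fin p ⊕ Fin m => q (Sum.inr s) := by
    ext s
    simp
    ring
  have hne : 1 + t ≠ 0 := fun h => ht (by linear_combination h)
  refine ⟨?_, ?_, ?_⟩
  · rwa [hl]
  · rw [hr]
    exact smul_ne_zero hne h2
  · rw [hl, hr, Matrix.smul_vecMul, h3, smul_zero]

theorem vecMul_eq_zero_of_mem_tangentAt_HconeA {n p m : ℕ} {F : Fin p → MvPolynomial (Fin n) ℚ}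
    {a : Matrix (Fin m) (Fin n) ℂ} {q v : (Fin n ⊕ (Fin p ⊕ Fin m)) → ℂ}
    (hv : v ∈ tangentAt (HconeA F a) q) (hvert : ∀ l, v (Sum.inl l) = 0) :
    Matrix.vecMul (fun s => v (Sum.inr s))
      (Matrix.fromRows (jacC F fun l => q (Sum.inl l)) a) = 0 := by
  ext l
  let N : Fin p ⊕ Fin m → MvPolynomial (Fin n ⊕ (Fin p ⊕ Fin m)) ℂ := fun s =>
    MvPolynomial.rename Sum.inl (polarMatrixPoly F a s l)
  have hN : ∀ (r : (Fin n ⊕ (Fin p ⊕ Fin m)) → ℂ) s, MvPolynomial.eval r (N s) =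
      Matrix.fromRows (jacC F fun l => r (Sum.inl l)) a s l := by
    intro r s
    rw [← eval_polarMatrixPoly, MvPolynomial.eval_rename]
    rfl
  have hderiv : ∀ s t, MvPolynomial.pderiv (Sum.inr t) (N s) = 0 := by
    intro s t
    refine MvPolynomial.pderiv_eq_zero_of_notMem_vars fun hmem => ?_
    obtain ⟨j, -, hj⟩ := Finset.mem_image.1 (MvPolynomial.vars_rename _ _ hmem)
    exact Sum.inl_ne_inr hj
  have h := (mem_tangentAt _ _ _).1 hv (∑ s, MvPolynomial.X (Sum.inr s) * N s) fun r hr => by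
    rw [MvPolynomial.aeval_eq_eval]
    simpa [hN, Matrix.vecMul, dotProduct] using congrFun hr.2.2 l
  rw [Fintype.sum_sum_type] at h
  simpa [hvert, hderiv, hN, Derivation.leibniz, MvPolynomial.pderiv_X, Pi.single_apply,
    Matrix.vecMul, dotProduct, Finset.sum_mul, mul_comm, -Fintype.sum_sum_type] using h

/-- Where the left kernel of the Jacobian with the rows of `a` appended is a line, the vertical
tangent space of the cone of `H` is spanned by the scaling direction. -/
theorem finrank_tangentAt_HconeA_inf_ker {n p m : ℕ} {F : Fin p → MvPolynomial (Fin n) ℚ}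
    {a : Matrix (Fin m) (Fin n) ℂ} {q : (Fin n ⊕ (Fin p ⊕ Fin m)) → ℂ} (hq : q ∈ HconeA F a)
    (hker : Module.finrank ℂ (LinearMap.ker
      (Matrix.fromRows (jacC F fun l => q (Sum.inl l)) a).vecMulLinear) = 1) :
    Module.finrank ℂ ↥(tangentAt (HconeA F a) q ⊓ LinearMap.ker
      (LinearMap.funLeft ℂ ℂ (Sum.inl : Fin n → Fin n ⊕ (Fin p ⊕ Fin m)))) = 1 := by
  have hmem : Sum.elim (0 : Fin n → ℂ) (fun s => q (Sum.inr s)) ∈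
      tangentAt (HconeA F a) q ⊓ LinearMap.ker (LinearMap.funLeft ℂ ℂ (Sum.inl : Fin n → Fin n ⊕ (Fin p ⊕ Fin m))) := by
    refine ⟨mem_tangentAt_of_infinite _ _ _ ?_, (mem_ker_funLeft_inl _).2 fun l => rfl⟩
    exact (Set.finite_singleton (-1 : ℂ)).infinite_compl.mono
      fun t ht => add_smul_mem_HconeA hq ht
  refine finrank_eq_one_iff'.2 ⟨⟨_, hmem⟩, ?_, ?_⟩
  · intro h0
    refine hq.2.1 (funext fun s => ?_)
    exact congrFun (congrArg Subtype.val h0) (Sum.inr s)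
  · rintro ⟨v, hv1, hv2⟩
    have hvert := (mem_ker_funLeft_inl v).1 hv2
    obtain ⟨c, hc⟩ := (finrank_eq_one_iff_of_nonzero'
      (⟨fun s => q (Sum.inr s), hq.2.2⟩ : LinearMap.ker
        (Matrix.fromRows (jacC F fun l => q (Sum.inl l)) a).vecMulLinear)
      (fun h0 => hq.2.1 (congrArg Subtype.val h0))).1 hker
      ⟨fun s => v (Sum.inr s), vecMul_eq_zero_of_mem_tangentAt_HconeA hv1 hvert⟩
    refine ⟨c, Subtype.ext (funext fun s => ?_)⟩
    rcases s with l | s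
    · simp [hvert l]
    · exact congrFun (congrArg Subtype.val hc) s

/-- Proposition 2 of the paper. Suppose `S` is smooth,
`1 ≤ i ≤ n-p`, and that for a generic choice of `a` the polar variety
`W_{K^{n-p-i}(a)}(S)` is nonempty. Then for every `a` in a suitable nonempty Zariski
open set of full-rank matrices and every regular (smooth) point `x` of
`W_{K^{n-p-i}(a)}(S)` (i.e. one whose Zariski tangent space has dimension `n-p-i`):
`x ∉ Δ_i` iff the fiber `ω_i⁻¹(x)` is zero-dimensional (finite); and in this case
`ω_i : H_i → W_{K^{n-p-i}(a)}(S)` is unramified at every point of `ω_i⁻¹(x)`, i.e. at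
every point of the cone of `H_i` over `x` the vertical part of the tangent space of
`H_i` is reduced to the scaling direction (it has dimension `1`). -/
theorem statement11 {n p i : ℕ} (hp1 : 1 ≤ p) (hpn : p ≤ n)
    (hi1 : 1 ≤ i) (hi2 : i ≤ n - p)
    (F : Fin p → MvPolynomial (Fin n) ℚ)
    (hreg : IsRegSeq (List.ofFn F))
    (hrad : idealOfDef F)
    (hSne : (zeroSetC F).Nonempty)
    (hSdim : IsPureDim (zeroSetC F) (n - p))
    (hsmooth : SregC F = zeroSetC F)
    (hgen : ∃ U : Set (Matrix (Fin (n - p - i + 1)) (Fin n) ℂ),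
      ZOpenMat U ∧ U.Nonempty ∧
      ∀ a ∈ U, a.rank = n - p - i + 1 ∧ (Wclassic F a (n - i)).Nonempty) :
    ∃ O : Set (Matrix (Fin (n - p - i + 1)) (Fin n) ℂ),
      ZOpenMat O ∧ O.Nonempty ∧
      ∀ a ∈ O,
        a.rank = n - p - i + 1 ∧
        ∀ x ∈ Wclassic F a (n - i),
          Module.finrank ℂ ↥(tangentAt (Wclassic F a (n - i)) x) = n - p - i →
          ((x ∉ DeltaSet F a i ↔ (omegaFiber F a x).Finite) ∧
           (x ∉ DeltaSet F a i →
             ∀ q ∈ HconeA F a, (fun l => q (Sum.inl l)) = x →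
               Module.finrank ℂ
                 ↥(tangentAt (HconeA F a) q ⊓
                   LinearMap.ker (LinearMap.funLeft ℂ ℂ
                     (Sum.inl : Fin n → Fin n ⊕ (Fin p ⊕ Fin (n - p - i + 1))))) = 1)) := by
  obtain ⟨U, hU, hUne, hUa⟩ := hgen
  refine ⟨U, hU, hUne, fun a ha => ⟨(hUa a ha).1, fun x hx _ => ?_⟩⟩
  have hxS : x ∈ zeroSetC F := zcl_subset_zeroSetC F (fun y hy => hy.1.1) hx
  have hrank := rank_lt_of_mem_zcl F a
    (fun y hy => lt_of_le_of_lt hy.2 (by omega : n - i < p + (n - p - i + 1))) hx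
  have hsum := (Matrix.fromRows (jacC F x) a).finrank_ker_vecMulLinear_add_rank
  rw [Fintype.card_sum, Fintype.card_fin, Fintype.card_fin] at hsum
  have hDelta : x ∉ DeltaSet F a i ↔ Module.finrank ℂ
      (LinearMap.ker (Matrix.fromRows (jacC F x) a).vecMulLinear) = 1 := by
    have : x ∈ DeltaSet F a i ↔ (Matrix.fromRows (jacC F x) a).rank ≤ n - i - 1 :=
      and_iff_right hxS
    rw [this]
    omega
  refine ⟨?_, fun hnot q hq hqx => ?_⟩
  · rw [hDelta]
    exact (Projectivization.finite_rep_mem_iff_finrank_eq_one _ (by omega)).symm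
  · subst hqx
    exact finrank_tangentAt_HconeA_inf_ker hq (hDelta.1 hnot)
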